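/- The plucking polynomial does not depend on the plane embedding: if a plane rooted tree T′ is obtained from a plane rooted tree T by permuting the left-to-right order of the children of some of its vertices (so that T and T′ have the same underlying abstract rooted tree), then Q(T) = Q(T′). -/

import Mathlib

/-- A plane rooted tree: a root with an ordered list of plane rooted subtrees. -/
inductive PTree : Type where
  | node : List PTree → PTree

namespace PTree

mutual
/-- Number of edges of a plane rooted tree. -/
def edges : PTree → ℕ
  | .node l => edgesL l
def edgesL : List PTree → ℕ
  | [] => 0
  | t :: ts => (edges t + 1) + edgesL ts
end

mutual
/-- Number of vertices of a plane rooted tree. -/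
def vertices : PTree → ℕ
  | .node l => 1 + verticesL l
def verticesL : List PTree → ℕ
  | [] => 0
  | t :: ts => vertices t + verticesL ts
end

mutual
/-- `plucks T` is the list, indexed by the leaves `v` of `T`, of the pairs
`(r(T,v), T - v)`, where `r(T,v)` is the number of vertices strictly to the
right of the path from `v` to the root, and `T - v` is `T` with the leaf `v`
(and its edge) deleted. -/
def plucks : PTree → List (ℕ × PTree)
  | .node l => (plucksL l).map (fun p => (p.1, PTree.node p.2))
def plucksL : List PTree → List (ℕ × List PTree)
  | [] => []
  | t :: ts =>
      (match t with
       | .node [] => [(verticesL ts, ts)]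
       | .node (s :: ss) =>
          (plucks (.node (s :: ss))).map (fun p => (p.1 + verticesL ts, p.2 :: ts)))
      ++ (plucksL ts).map (fun p => (p.1, t :: p.2))
end

/-- The plucking polynomial, computed with a fuel parameter (the fuel is the
number of edges; each plucking removes exactly one edge). -/
noncomputable def Qfuel : ℕ → PTree → Polynomial ℤ
  | 0, _ => 1
  | (k+1), t =>
      if edges t = 0 then 1
      else ((plucks t).map (fun p => Polynomial.X ^ p.1 * Qfuel k p.2)).sum

/-- The plucking polynomial `Q(T)` of a plane rooted tree: `Q(T) = 1` if `T` has
no edges, and otherwise `Q(T) = Σ_v q^{r(T,v)} Q(T - v)`, summed over the leaves of `T`. -/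
noncomputable def Q (t : PTree) : Polynomial ℤ := Qfuel (edges t) t

end PTree

/-- The `q`-analogue `[a]_q = 1 + q + ⋯ + q^{a-1}`. -/
noncomputable def qInt (a : ℕ) : Polynomial ℤ := (Finset.range a).sum (fun i => Polynomial.X ^ i)

/-- The `q`-factorial `[a]_q! = [1]_q [2]_q ⋯ [a]_q`. -/
noncomputable def qFact : ℕ → Polynomial ℤ
  | 0 => 1
  | (a+1) => qFact a * qInt (a+1)

/-- The `q`-multinomial coefficient
`(a₁+⋯+a_k choose a₁,…,a_k)_q = [a₁+⋯+a_k]_q! / ([a₁]_q! ⋯ [a_k]_q!)`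
(the division, by a monic polynomial, is exact). -/
noncomputable def qMultinomial (l : List ℕ) : Polynomial ℤ :=
  qFact l.sum /ₘ (l.map qFact).prod

/-- The Gaussian binomial coefficient `(a+c choose a)_q`. -/
noncomputable def qBinom (a c : ℕ) : Polynomial ℤ := qMultinomial [a, c]


/-- `PermTree T T'` holds when `T'` is obtained from `T` by permuting the left-to-right
order of the children of some of its vertices (so `T` and `T'` have the same underlying
abstract rooted tree). -/
inductive PermTree : PTree → PTree → Prop where
  | node {l₁ l₂ l₃ : List PTree} :
      List.Forall₂ PermTree l₁ l₂ → l₂.Perm l₃ → PermTree (.node l₁) (.node l₃)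

open Polynomial

theorem qInt_add (a b : ℕ) : qInt (a + b) = X ^ b * qInt a + qInt b := by
  unfold qInt
  rw [add_comm a b, Finset.sum_range_add, Finset.mul_sum, add_comm]
  simp only [pow_add]

theorem qInt_one : qInt 1 = 1 := by simp [qInt]

theorem qInt_ne_zero {a : ℕ} (ha : a ≠ 0) : qInt a ≠ 0 := by
  intro h
  have h1 := congrArg (Polynomial.eval 1) h
  simp [qInt, Polynomial.eval_finsetSum] at h1
  exact ha h1

namespace PTree

mutual
/-- The product of `[h_v]_q` over the non-root vertices `v`, where `h_v` is the number of
vertices of the subtree rooted at `v`. -/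
noncomputable def hookProd : PTree → ℤ[X]
  | .node l => hookProdL l
/-- The product of `[h_v]_q` over all vertices `v` of a list of trees. -/
noncomputable def hookProdL : List PTree → ℤ[X]
  | [] => 1
  | t :: ts => hookProd t * qInt (vertices t) * hookProdL ts
end

mutual
theorem vertices_eq_edges_add_one : ∀ t : PTree, vertices t = edges t + 1
  | .node l => by simp only [vertices, edges, verticesL_eq_edgesL l]; ring
theorem verticesL_eq_edgesL : ∀ l : List PTree, verticesL l = edgesL l
  | [] => by simp only [verticesL, edgesL]
  | t :: ts => by
    simp only [verticesL, edgesL, vertices_eq_edges_add_one t, verticesL_eq_edgesL ts]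
end

theorem vertices_ne_zero (t : PTree) : vertices t ≠ 0 := by
  rw [vertices_eq_edges_add_one]; omega

mutual
theorem hookProd_ne_zero : ∀ t : PTree, hookProd t ≠ 0
  | .node l => by simpa only [hookProd] using hookProdL_ne_zero l
theorem hookProdL_ne_zero : ∀ l : List PTree, hookProdL l ≠ 0
  | [] => by simp only [hookProdL]; exact one_ne_zero
  | t :: ts => by
    simp only [hookProdL]
    exact mul_ne_zero (mul_ne_zero (hookProd_ne_zero t) (qInt_ne_zero (vertices_ne_zero t)))
      (hookProdL_ne_zero ts)
end

mutual
theorem vertices_of_mem_plucks :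
    ∀ (t : PTree) (p : ℕ × PTree), p ∈ plucks t → vertices p.2 + 1 = vertices t
  | .node l, p, hp => by
    simp only [plucks, List.mem_map] at hp
    obtain ⟨a, ha, rfl⟩ := hp
    simp only [vertices, ← verticesL_of_mem_plucksL l a ha]
    ring
theorem verticesL_of_mem_plucksL :
    ∀ (l : List PTree) (p : ℕ × List PTree), p ∈ plucksL l → verticesL p.2 + 1 = verticesL l
  | [], p, hp => by simp [plucksL] at hp
  | t :: ts, p, hp => by
    have ht := vertices_of_mem_plucks t
    have hts := verticesL_of_mem_plucksL ts
    rw [plucksL.eq_def] at hp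
    dsimp only at hp
    rw [List.mem_append] at hp
    rcases hp with hp | hp
    · match t, ht, hp with
      | .node [], _, hp =>
        rw [List.mem_singleton] at hp
        subst hp
        simp only [verticesL, vertices]; ring
      | .node (s :: ss), ht, hp =>
        obtain ⟨a, ha, rfl⟩ := List.mem_map.1 hp
        simp only [verticesL, ← ht a ha]; ring
    · obtain ⟨a, ha, rfl⟩ := List.mem_map.1 hp
      simp only [verticesL, ← hts a ha]; ring
end

local notation "toFrac" => algebraMap ℤ[X] (FractionRing ℤ[X])

theorem toFrac_ne_zero {p : ℤ[X]} (hp : p ≠ 0) : toFrac p ≠ 0 :=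
  IsFractionRing.to_map_ne_zero_of_mem_nonZeroDivisors (mem_nonZeroDivisors_of_ne_zero hp)

mutual
theorem sum_plucks_div_hookProd :
    ∀ t : PTree, ((plucks t).map fun p => toFrac (X ^ p.1) / toFrac (hookProd p.2)).sum =
      toFrac (qInt (edges t)) / toFrac (hookProd t)
  | .node l => by
    have h := sum_plucksL_div_hookProdL l
    simp only [plucks, List.map_map, Function.comp_def, hookProd, edges, h, verticesL_eq_edgesL]
theorem sum_plucksL_div_hookProdL :
    ∀ l : List PTree, ((plucksL l).map fun p => toFrac (X ^ p.1) / toFrac (hookProdL p.2)).sum =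
      toFrac (qInt (verticesL l)) / toFrac (hookProdL l)
  | [] => by simp [plucksL, verticesL, qInt]
  | t :: ts => by
    have ht := sum_plucks_div_hookProd t
    have hts := sum_plucksL_div_hookProdL ts
    have hmem := vertices_of_mem_plucks t
    have hHt := toFrac_ne_zero (hookProd_ne_zero t)
    have hHts := toFrac_ne_zero (hookProdL_ne_zero ts)
    have hV := toFrac_ne_zero (qInt_ne_zero (vertices_ne_zero t))
    have hright : (((plucksL ts).map fun p => (p.1, t :: p.2)).map
        fun p => toFrac (X ^ p.1) / toFrac (hookProdL p.2)).sum =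
        toFrac (qInt (verticesL ts)) / toFrac (hookProdL (t :: ts)) := by
      have hterm : ∀ p : ℕ × List PTree,
          toFrac (X ^ p.1) / toFrac (hookProdL (t :: p.2)) =
          (toFrac (hookProd t) * toFrac (qInt (vertices t)))⁻¹ *
            (toFrac (X ^ p.1) / toFrac (hookProdL p.2)) := by
        intro p
        have := toFrac_ne_zero (hookProdL_ne_zero p.2)
        simp only [hookProdL, map_mul]
        field_simp
      simp only [List.map_map, Function.comp_def, hterm]
      rw [List.sum_map_mul_left, hts]
      simp only [hookProdL, map_mul]
      field_simp
    rw [plucksL.eq_def]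
    dsimp only
    rw [List.map_append, List.sum_append, hright, verticesL, qInt_add]
    rw [map_add, add_div]
    congr 1
    match t, ht, hmem, hHt, hV with
    | .node [], _, _, _, _ =>
      simp [hookProdL, hookProd, vertices, verticesL, qInt_one]
    | .node (s :: ss), ht, hmem, hHt, hV =>
      dsimp only
      generalize hT : PTree.node (s :: ss) = T at *
      have he : edges T ≠ 0 := by
        subst hT; simp [edges, edgesL]
      have hE := toFrac_ne_zero (qInt_ne_zero he)
      have hterm : ∀ p ∈ plucks T,
          toFrac (X ^ (p.1 + verticesL ts)) / toFrac (hookProdL (p.2 :: ts)) =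
          toFrac (X ^ verticesL ts) / (toFrac (qInt (edges T)) * toFrac (hookProdL ts)) *
            (toFrac (X ^ p.1) / toFrac (hookProd p.2)) := by
        intro p hp
        have h1 := toFrac_ne_zero (hookProd_ne_zero p.2)
        have h2 : vertices p.2 = edges T := by
          have := hmem p hp
          rw [vertices_eq_edges_add_one T] at this
          omega
        simp only [hookProdL, map_mul, pow_add, h2]
        field_simp
      simp only [List.map_map, Function.comp_def]
      rw [List.map_congr_left hterm, List.sum_map_mul_left, ht]
      simp only [hookProdL, map_mul]
      field_simp
end

/-- The `q`-hook length formula for the plucking polynomial. -/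
theorem toFrac_Qfuel (n : ℕ) : ∀ t : PTree, edges t = n →
    toFrac (Qfuel n t) = toFrac (qFact n) / toFrac (hookProd t) := by
  induction n with
  | zero =>
    rintro ⟨l⟩ h
    cases l with
    | nil => simp [Qfuel, qFact, hookProd, hookProdL]
    | cons s ss => simp [edges, edgesL] at h
  | succ n ih =>
    intro t h
    have hterm : ∀ p ∈ plucks t, toFrac (X ^ p.1 * Qfuel n p.2) =
        toFrac (qFact n) * (toFrac (X ^ p.1) / toFrac (hookProd p.2)) := by
      intro p hp
      have h1 := vertices_of_mem_plucks t p hp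
      rw [vertices_eq_edges_add_one, vertices_eq_edges_add_one] at h1
      rw [map_mul, ih p.2 (by omega)]
      ring
    rw [Qfuel, if_neg (by omega), map_list_sum, List.map_map]
    simp only [Function.comp_def]
    rw [List.map_congr_left hterm, List.sum_map_mul_left, sum_plucks_div_hookProd, h, qFact,
      map_mul, mul_div_assoc]

theorem Q_mul_hookProd (t : PTree) : Q t * hookProd t = qFact (edges t) := by
  apply IsFractionRing.injective ℤ[X] (FractionRing ℤ[X])
  rw [map_mul, Q, toFrac_Qfuel _ t rfl, div_mul_cancel₀ _ (toFrac_ne_zero (hookProd_ne_zero t))]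

theorem edgesL_eq_sum (l : List PTree) : edgesL l = (l.map fun t => edges t + 1).sum := by
  induction l with
  | nil => simp [edgesL]
  | cons t ts ih => simp [edgesL, ih]

theorem hookProdL_eq_prod (l : List PTree) :
    hookProdL l = (l.map fun t => hookProd t * qInt (vertices t)).prod := by
  induction l with
  | nil => simp [hookProdL]
  | cons t ts ih => simp [hookProdL, ih]

end PTree

open PTree in
mutual
theorem PermTree.edges_eq_and_hookProd_eq {T T' : PTree} (h : PermTree T T') :
    edges T = edges T' ∧ hookProd T = hookProd T' := by
  match h with
  | .node (l₁ := l₁) (l₂ := l₂) (l₃ := l₃) hl hp =>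
    have ⟨h1, h2⟩ := PermTree.edgesL_eq_and_hookProdL_eq hl
    simp only [edges, hookProd, h1, h2, edgesL_eq_sum, hookProdL_eq_prod]
    exact ⟨(hp.map _).sum_eq, (hp.map _).prod_eq⟩
theorem PermTree.edgesL_eq_and_hookProdL_eq {l l' : List PTree}
    (h : List.Forall₂ PermTree l l') :
    edgesL l = edgesL l' ∧ hookProdL l = hookProdL l' := by
  match h with
  | .nil => exact ⟨rfl, rfl⟩
  | .cons ht hts =>
    have ⟨h1, h2⟩ := PermTree.edges_eq_and_hookProd_eq ht
    have ⟨h3, h4⟩ := PermTree.edgesL_eq_and_hookProdL_eq hts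
    simp only [edgesL, hookProdL, vertices_eq_edges_add_one, h1, h2, h3, h4, and_self]
end

/-- **Independence of the plane embedding.** If a plane rooted tree `T'` is obtained from
a plane rooted tree `T` by permuting the order of the children of some of its vertices,
then `Q(T) = Q(T')`. -/
theorem plucking_perm_invariant (T T' : PTree) (h : PermTree T T') :
    PTree.Q T = PTree.Q T' := by
  obtain ⟨he, hh⟩ := h.edges_eq_and_hookProd_eq
  apply mul_right_cancel₀ (PTree.hookProd_ne_zero T)
  rw [PTree.Q_mul_hookProd, he, hh, PTree.Q_mul_hookProd]
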